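/- arXiv:2305.13552 — 6 statements merged into one kernel-verified Lean document; each statement's English description precedes it below -/
import Mathlib

section
/- Let (X, μ) be a measure space, let σ : ℝ → ℝ, t : X → ℝ^D measurable, W ∈ ℝ^{n×D} with rows w_1,…,w_n, b ∈ ℝ^n, and V ∈ ℝ^{m×n}. Assume that for all i, j the function x ↦ σ(w_iᵀ t(x) + b_i) σ(w_jᵀ t(x) + b_j) is integrable with respect to μ. Then the normalising constant Z(V, Θ) = ∫_X ‖V σ(W t(x) + b)‖₂² μ(dx) is finite and equals Tr(Vᵀ V K_Θ), where K_Θ is the n×n matrix with entries [K_Θ]_{ij} = ∫_X σ(w_iᵀ t(x) + b_i) σ(w_jᵀ t(x) + b_j) μ(dx). -/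
open MeasureTheory Matrix

/-- A sum of squares of linear forms `∑ r, (∑ j, V r j * u j) ^ 2`, expanded as a quadratic form
in `u` with Gram matrix `Vᵀ * V`. -/
theorem sum_sq_linear_eq_sum_gram {ι κ : Type*} [Fintype ι] [Fintype κ]
    (V : Matrix κ ι ℝ) (u : ι → ℝ) :
    ∑ r, (∑ j, V r j * u j) ^ 2 = ∑ i, ∑ j, (Vᵀ * V) i j * (u j * u i) := by
  simp_rw [sq, Finset.sum_mul_sum, mul_apply, transpose_apply, Finset.sum_mul]
  rw [Finset.sum_comm]
  refine Finset.sum_congr rfl fun i _ => ?_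
  rw [Finset.sum_comm]
  refine Finset.sum_congr rfl fun j _ => Finset.sum_congr rfl fun r _ => ?_
  ring

theorem integrable_sum_sq_linear {X ι κ : Type*} [Fintype ι] [Fintype κ] [MeasurableSpace X]
    {μ : Measure X} (V : Matrix κ ι ℝ) {φ : ι → X → ℝ}
    (hφ : ∀ i j, Integrable (fun x => φ i x * φ j x) μ) :
    Integrable (fun x => ∑ r, (∑ j, V r j * φ j x) ^ 2) μ := by
  simp_rw [fun x => sum_sq_linear_eq_sum_gram V fun j => φ j x]
  exact integrable_finsetSum _ fun i _ => integrable_finsetSum _ fun j _ => (hφ j i).const_mul _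

theorem integral_sum_sq_linear_eq_trace {X ι κ : Type*} [Fintype ι] [Fintype κ]
    [MeasurableSpace X] {μ : Measure X} (V : Matrix κ ι ℝ) {φ : ι → X → ℝ}
    (hφ : ∀ i j, Integrable (fun x => φ i x * φ j x) μ) :
    ∫ x, ∑ r, (∑ j, V r j * φ j x) ^ 2 ∂μ =
      trace (Vᵀ * V * of fun i j => ∫ x, φ i x * φ j x ∂μ) := by
  have h (i j : ι) : Integrable (fun x => (Vᵀ * V) i j * (φ j x * φ i x)) μ :=
    (hφ j i).const_mul _
  simp_rw [fun x => sum_sq_linear_eq_sum_gram V fun j => φ j x]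
  rw [integral_finsetSum _ fun i _ => integrable_finsetSum _ fun j _ => h i j]
  simp_rw [trace, diag_apply, mul_apply (M := Vᵀ * V), of_apply]
  refine Finset.sum_congr rfl fun i _ => ?_
  rw [integral_finsetSum _ fun j _ => h i j]
  exact Finset.sum_congr rfl fun j _ => integral_const_mul _ _

/-- for a SNEFY model, if all pairwise products of activations are
`μ`-integrable, then the normalising constant `Z = ∫ ‖V σ(W t(x) + b)‖₂² dμ` is
finite (the integrand is integrable) and equals `Tr(Vᵀ V K_Θ)` where
`[K_Θ]_{ij} = ∫ σ(wᵢᵀ t(x) + bᵢ) σ(w_jᵀ t(x) + b_j) dμ`. -/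
theorem snefy_normalising_constant_eq_trace
    {X : Type*} [MeasurableSpace X] (μ : Measure X)
    (m n D : ℕ) (σ : ℝ → ℝ) (t : X → Fin D → ℝ) (ht : Measurable t)
    (W : Matrix (Fin n) (Fin D) ℝ) (b : Fin n → ℝ)
    (V : Matrix (Fin m) (Fin n) ℝ)
    (hint : ∀ i j : Fin n, Integrable (fun x =>
      σ (∑ k : Fin D, W i k * t x k + b i) *
      σ (∑ k : Fin D, W j k * t x k + b j)) μ) :
    Integrable (fun x =>
        ∑ r : Fin m, (∑ j : Fin n, V r j * σ (∑ k : Fin D, W j k * t x k + b j)) ^ 2) μ ∧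
    ∫ x, (∑ r : Fin m, (∑ j : Fin n, V r j * σ (∑ k : Fin D, W j k * t x k + b j)) ^ 2) ∂μ =
      Matrix.trace (Vᵀ * V *
        Matrix.of (fun i j : Fin n =>
          ∫ x, σ (∑ k : Fin D, W i k * t x k + b i) *
               σ (∑ k : Fin D, W j k * t x k + b j) ∂μ)) :=
  ⟨integrable_sum_sq_linear V hint, integral_sum_sq_linear_eq_trace V hint⟩
end

section
/- Let σ(u) = exp(u/2), t : X → ℝ^D, W ∈ ℝ^{n×D} with rows w_1,…,w_n, V ∈ ℝ^{m×n} with columns v_1,…,v_n, and fix x ∈ X with ‖V exp(½ W t(x))‖₂² > 0. Fix a coordinate k ∈ {1,…,D} and let E_k be the n×D matrix whose k-th column is all ones and all other entries zero. Then the map s ↦ log ‖V exp(½ (W + s E_k) t(x))‖₂² is differentiable at s = 0 with derivative t_k(x). -/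
open Matrix

/-- for the SNEFY network with activation `σ(u) = exp(u/2)`, at any point `x`
where the squared output norm is positive, the directional derivative of
`log ‖V exp(½ W t(x))‖₂²` along the matrix `E_k` (whose `k`-th column is all ones)
equals `t_k(x)`. -/
theorem snefy_log_sq_norm_deriv
    {X : Type*} (m n D : ℕ) (t : X → Fin D → ℝ)
    (V : Matrix (Fin m) (Fin n) ℝ) (W : Matrix (Fin n) (Fin D) ℝ)
    (x : X) (k : Fin D)
    (Ek : Matrix (Fin n) (Fin D) ℝ)
    (hEk : Ek = Matrix.of fun (_ : Fin n) (k' : Fin D) => if k' = k then (1 : ℝ) else 0)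
    (hpos : 0 < ∑ r : Fin m,
      (∑ j : Fin n, V r j * Real.exp (2⁻¹ * ∑ k' : Fin D, W j k' * t x k')) ^ 2) :
    HasDerivAt (fun s : ℝ => Real.log (∑ r : Fin m,
        (∑ j : Fin n, V r j *
          Real.exp (2⁻¹ * ∑ k' : Fin D, (W + s • Ek) j k' * t x k')) ^ 2))
      (t x k) 0 := by
  subst hEk
  have hpre (s : ℝ) (j : Fin n) :
      2⁻¹ * ∑ k' : Fin D, (W + s • Matrix.of
        fun (_ : Fin n) (k' : Fin D) => if k' = k then (1 : ℝ) else 0) j k' * t x k' =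
      2⁻¹ * (s * t x k) + 2⁻¹ * ∑ k' : Fin D, W j k' * t x k' := by
    simp [add_mul, Finset.sum_add_distrib]
    ring
  have hexp (s : ℝ) : Real.exp (2⁻¹ * (s * t x k)) ^ 2 = Real.exp (s * t x k) := by
    rw [← Real.exp_nat_mul]
    congr 1
    push_cast
    ring
  have hlog (s : ℝ) := Real.log_mul (Real.exp_pos (s * t x k)).ne' hpos.ne'
  simp_rw [hpre, Real.exp_add, mul_left_comm (V _ _), ← Finset.mul_sum, mul_pow, hexp,
    ← Finset.mul_sum, hlog, Real.log_exp]
  simpa using (hasDerivAt_id (0 : ℝ)).mul_const (t x k)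
end

section
/- Let μ₂ be a measure on X₂, let t₁ : X₁ → ℝ^{D₁} and t₂ : X₂ → ℝ^{D₂} be measurable, let W₁ ∈ ℝ^{n×D₁} with rows W_{1i}, W₂ ∈ ℝ^{n×D₂} with rows W_{2i}, b ∈ ℝ^n, V ∈ ℝ^{m×n}, and σ : ℝ → ℝ. Fix x₁ ∈ X₁ and assume that for all i, j the function x₂ ↦ σ(W_{1i}ᵀ t₁(x₁) + W_{2i}ᵀ t₂(x₂) + b_i) σ(W_{1j}ᵀ t₁(x₁) + W_{2j}ᵀ t₂(x₂) + b_j) is μ₂-integrable. Then ∫_{X₂} ‖V σ(W₁ t₁(x₁) + W₂ t₂(x₂) + b)‖₂² μ₂(dx₂) = Tr(Vᵀ V C̃(x₁)), where C̃(x₁) is the n×n matrix with entries C̃_{ij}(x₁) = ∫_{X₂} σ(W_{1i}ᵀ t₁(x₁) + W_{2i}ᵀ t₂(x₂) + b_i) σ(W_{1j}ᵀ t₁(x₁) + W_{2j}ᵀ t₂(x₂) + b_j) μ₂(dx₂). -/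
open MeasureTheory Matrix

/-- The integral of the squared Euclidean norm of `V f(x)` is the trace of `Vᵀ V` against the
matrix of second moments of `f`. -/
theorem integral_sum_sq_eq_trace {X ι κ : Type*} [Fintype ι] [Fintype κ] [MeasurableSpace X]
    (μ : Measure X) (V : Matrix κ ι ℝ) (f : ι → X → ℝ)
    (hf : ∀ i j, Integrable (fun x => f i x * f j x) μ) :
    ∫ x, ∑ r, (∑ j, V r j * f j x) ^ 2 ∂μ =
      Matrix.trace (Vᵀ * V * Matrix.of fun i j => ∫ x, f i x * f j x ∂μ) := by
  have expand : ∀ x, ∑ r, (∑ j, V r j * f j x) ^ 2 =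
      ∑ i, ∑ j, (∑ r, V r i * V r j) * (f j x * f i x) := by
    intro x
    simp_rw [sq, Finset.sum_mul_sum, Finset.sum_mul]
    rw [Finset.sum_comm]
    refine Finset.sum_congr rfl fun i _ => ?_
    rw [Finset.sum_comm]
    refine Finset.sum_congr rfl fun j _ => Finset.sum_congr rfl fun r _ => ?_
    ring
  simp_rw [expand]
  rw [integral_finsetSum _ fun i _ => integrable_finsetSum _ fun j _ => (hf j i).const_mul _]
  simp only [Matrix.trace, Matrix.diag_apply, Matrix.mul_apply, Matrix.transpose_apply,
    Matrix.of_apply]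
  refine Finset.sum_congr rfl fun i _ => ?_
  rw [integral_finsetSum _ fun j _ => (hf j i).const_mul _]
  exact Finset.sum_congr rfl fun j _ => integral_const_mul _ _

/-- marginalising the squared SNEFY network output over `x₂` gives
`∫ ‖V σ(W₁ t₁(x₁) + W₂ t₂(x₂) + b)‖₂² dμ₂ = Tr(Vᵀ V C̃(x₁))`, where
`C̃(x₁)_{ij}` is the `μ₂`-integral of the product of the `i`-th and `j`-th activations. -/
theorem snefy_marginalisation_trace
    {X₁ X₂ : Type*} [MeasurableSpace X₂] (μ₂ : Measure X₂)
    (m n D₁ D₂ : ℕ) (σ : ℝ → ℝ)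
    (t₁ : X₁ → Fin D₁ → ℝ) (t₂ : X₂ → Fin D₂ → ℝ) (ht₂ : Measurable t₂)
    (W₁ : Matrix (Fin n) (Fin D₁) ℝ) (W₂ : Matrix (Fin n) (Fin D₂) ℝ)
    (b : Fin n → ℝ) (V : Matrix (Fin m) (Fin n) ℝ) (x₁ : X₁)
    (hint : ∀ i j : Fin n, Integrable (fun x₂ =>
      σ (∑ k : Fin D₁, W₁ i k * t₁ x₁ k + ∑ k : Fin D₂, W₂ i k * t₂ x₂ k + b i) *
      σ (∑ k : Fin D₁, W₁ j k * t₁ x₁ k + ∑ k : Fin D₂, W₂ j k * t₂ x₂ k + b j)) μ₂) :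
    ∫ x₂, (∑ r : Fin m, (∑ j : Fin n, V r j *
        σ (∑ k : Fin D₁, W₁ j k * t₁ x₁ k + ∑ k : Fin D₂, W₂ j k * t₂ x₂ k + b j)) ^ 2) ∂μ₂ =
      Matrix.trace (Vᵀ * V *
        Matrix.of (fun i j : Fin n =>
          ∫ x₂, σ (∑ k : Fin D₁, W₁ i k * t₁ x₁ k + ∑ k : Fin D₂, W₂ i k * t₂ x₂ k + b i) *
                σ (∑ k : Fin D₁, W₁ j k * t₁ x₁ k + ∑ k : Fin D₂, W₂ j k * t₂ x₂ k + b j) ∂μ₂)) := by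
  exact integral_sum_sq_eq_trace μ₂ V (fun i x₂ =>
    σ (∑ k : Fin D₁, W₁ i k * t₁ x₁ k + ∑ k : Fin D₂, W₂ i k * t₂ x₂ k + b i)) hint
end

section
/- Let d ≥ 1, let γ be the standard Gaussian probability measure on ℝ^d (the d-fold product of gaussianReal 0 1), and let w_i, w_j ∈ ℝ^d, b_i, b_j ∈ ℝ. Then ∫_{ℝ^d} cos(⟨w_i, x⟩ + b_i) cos(⟨w_j, x⟩ + b_j) γ(dx) = ½ cos(b_i − b_j) exp(−½ ‖w_i − w_j‖²) + ½ cos(b_i + b_j) exp(−½ ‖w_i + w_j‖²). -/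
open MeasureTheory ProbabilityTheory

/-- The characteristic function of the standard Gaussian measure on `Fin d → ℝ`. -/
theorem integral_cexp_pi_gaussianReal {d : ℕ} (v : Fin d → ℝ) :
    ∫ x : Fin d → ℝ, Complex.exp ((∑ l, v l * x l : ℝ) * Complex.I)
        ∂(Measure.pi fun _ : Fin d => gaussianReal 0 1) =
      (Real.exp (-(2⁻¹ : ℝ) * ∑ l, v l ^ 2) : ℝ) := by
  have hprod (x : Fin d → ℝ) : Complex.exp ((∑ l, v l * x l : ℝ) * Complex.I) =
      ∏ l, Complex.exp (v l * x l * Complex.I) := by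
    rw [← Complex.exp_sum, ← Finset.sum_mul]
    push_cast
    rfl
  have hfactor (l : Fin d) : ∫ y : ℝ, Complex.exp (v l * y * Complex.I) ∂gaussianReal 0 1 =
      Complex.exp (-(2⁻¹ : ℂ) * (v l : ℂ) ^ 2) := by
    rw [← charFun_apply_real, charFun_gaussianReal]
    congr 1
    push_cast
    ring
  simp_rw [hprod]
  rw [integral_fintype_prod_eq_prod
    (f := fun l (y : ℝ) => Complex.exp (v l * y * Complex.I))]
  simp_rw [hfactor]
  rw [← Complex.exp_sum, ← Finset.mul_sum]
  push_cast
  rfl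

theorem integrable_cos_sum_add {d : ℕ} (μ : Measure (Fin d → ℝ)) [IsFiniteMeasure μ]
    (v : Fin d → ℝ) (b : ℝ) : Integrable (fun x => Real.cos (∑ l, v l * x l + b)) μ :=
  .of_bound (Continuous.aestronglyMeasurable (by fun_prop)) 1
    (.of_forall fun _ => Real.abs_cos_le_one _)

/-- The mean of a shifted cosine feature under the standard Gaussian measure. -/
theorem integral_cos_pi_gaussianReal {d : ℕ} (v : Fin d → ℝ) (b : ℝ) :
    ∫ x : Fin d → ℝ, Real.cos (∑ l, v l * x l + b)
        ∂(Measure.pi fun _ : Fin d => gaussianReal 0 1) =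
      Real.cos b * Real.exp (-(2⁻¹ : ℝ) * ∑ l, v l ^ 2) := by
  set γ := Measure.pi fun _ : Fin d => gaussianReal 0 1
  have hint : Integrable
      (fun x : Fin d → ℝ => Complex.exp ((∑ l, v l * x l + b : ℝ) * Complex.I)) γ :=
    .of_bound (Continuous.aestronglyMeasurable (by fun_prop)) 1
      (.of_forall fun _ => (Complex.norm_exp_ofReal_mul_I _).le)
  have hre := integral_re hint
  simp only [RCLike.re_eq_complex_re, Complex.exp_ofReal_mul_I_re] at hre
  rw [hre]
  have hsplit (x : Fin d → ℝ) : Complex.exp ((∑ l, v l * x l + b : ℝ) * Complex.I) =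
      Complex.exp ((∑ l, v l * x l : ℝ) * Complex.I) * Complex.exp (b * Complex.I) := by
    rw [← Complex.exp_add, Complex.ofReal_add, add_mul]
  simp_rw [hsplit]
  rw [integral_mul_const, integral_cexp_pi_gaussianReal, Complex.re_ofReal_mul,
    Complex.exp_ofReal_mul_I_re, mul_comm]

/-- the cosine neural network kernel under the standard Gaussian measure:
`∫ cos(⟨wᵢ,x⟩+bᵢ) cos(⟨w_j,x⟩+b_j) dγ
  = ½ cos(bᵢ−b_j) e^{−½‖wᵢ−w_j‖²} + ½ cos(bᵢ+b_j) e^{−½‖wᵢ+w_j‖²}`. -/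
theorem cos_kernel_standard_gaussian
    (d : ℕ) (hd : 1 ≤ d) (wi wj : Fin d → ℝ) (bi bj : ℝ) :
    ∫ x : Fin d → ℝ,
        Real.cos (∑ l : Fin d, wi l * x l + bi) * Real.cos (∑ l : Fin d, wj l * x l + bj)
        ∂(Measure.pi fun _ : Fin d => gaussianReal 0 1) =
      2⁻¹ * Real.cos (bi - bj) * Real.exp (-(2⁻¹ : ℝ) * ∑ l : Fin d, (wi l - wj l) ^ 2) +
      2⁻¹ * Real.cos (bi + bj) * Real.exp (-(2⁻¹ : ℝ) * ∑ l : Fin d, (wi l + wj l) ^ 2) := by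
  have hcos (x : Fin d → ℝ) :
      Real.cos (∑ l, wi l * x l + bi) * Real.cos (∑ l, wj l * x l + bj) =
        2⁻¹ * Real.cos (∑ l, (wi l - wj l) * x l + (bi - bj)) +
        2⁻¹ * Real.cos (∑ l, (wi l + wj l) * x l + (bi + bj)) := by
    simp_rw [sub_mul, add_mul, Finset.sum_sub_distrib, Finset.sum_add_distrib]
    rw [sub_add_sub_comm, add_add_add_comm, Real.cos_sub, Real.cos_add (_ + _)]
    ring
  simp_rw [hcos]
  rw [integral_add ((integrable_cos_sum_add _ _ _).const_mul _)
      ((integrable_cos_sum_add _ _ _).const_mul _), integral_const_mul, integral_const_mul,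
    integral_cos_pi_gaussianReal, integral_cos_pi_gaussianReal, mul_assoc, mul_assoc]
end

section
/- Let d ≥ 1, let γ be the standard Gaussian probability measure on ℝ^d (the d-fold product of gaussianReal 0 1), let a > 0, and set σ(u) = snake_a(u) − 1/(2a) = u − cos(2au)/(2a). For w_i, w_j ∈ ℝ^d and b_i, b_j ∈ ℝ, ∫_{ℝ^d} σ(⟨w_i,x⟩+b_i) σ(⟨w_j,x⟩+b_j) γ(dx) = (1/(4a²))[½ cos(2a(b_i−b_j)) exp(−2a²‖w_i−w_j‖²) + ½ cos(2a(b_i+b_j)) exp(−2a²‖w_i+w_j‖²)] + ⟨w_i,w_j⟩ [sin(2a b_j) exp(−2a²‖w_j‖²) + sin(2a b_i) exp(−2a²‖w_i‖²)] − (b_i/(2a)) cos(2a b_j) exp(−2a²‖w_j‖²) − (b_j/(2a)) cos(2a b_i) exp(−2a²‖w_i‖²) + ⟨w_i,w_j⟩ + b_i b_j. -/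
open MeasureTheory ProbabilityTheory

/-- The snake activation with frequency `a`: `snake_a(u) = u + sin²(au)/a`. -/
noncomputable def snake (a u : ℝ) : ℝ := u + Real.sin (a * u) ^ 2 / a

open scoped RealInnerProductSpace

section StdGaussian

variable {E : Type*} [NormedAddCommGroup E] [InnerProductSpace ℝ E] [FiniteDimensional ℝ E]
  [MeasurableSpace E] [BorelSpace E]

lemma integrable_inner_stdGaussian (u : E) :
    Integrable (fun x : E => ⟪u, x⟫) (stdGaussian E) :=
  (innerSL ℝ u).integrable_comp IsGaussian.integrable_id

lemma memLp_inner_stdGaussian (u : E) :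
    MemLp (fun x : E => ⟪u, x⟫) 2 (stdGaussian E) :=
  IsGaussian.memLp_dual (stdGaussian E) (innerSL ℝ u) 2 (by simp)

lemma integral_inner_stdGaussian (u : E) : ∫ x, ⟪u, x⟫ ∂(stdGaussian E) = 0 :=
  integral_strongDual_stdGaussian (innerSL ℝ u)

lemma integral_inner_mul_inner_stdGaussian (u v : E) :
    ∫ x, ⟪u, x⟫ * ⟪v, x⟫ ∂(stdGaussian E) = ⟪u, v⟫ := by
  have h := covarianceBilin_apply (μ := stdGaussian E) IsGaussian.memLp_two_id u v
  rw [covarianceBilin_stdGaussian, innerSL_apply_apply ℝ] at h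
  simpa [integral_id_stdGaussian] using h.symm

lemma integrable_cos_inner_add (μ : Measure E) [IsFiniteMeasure μ] (t : E) (c : ℝ) :
    Integrable (fun x : E => Real.cos (⟪t, x⟫ + c)) μ :=
  .of_bound (by fun_prop) 1 (.of_forall fun x => by simpa using Real.abs_cos_le_one _)

lemma integrable_sin_inner_add (μ : Measure E) [IsFiniteMeasure μ] (t : E) (c : ℝ) :
    Integrable (fun x : E => Real.sin (⟪t, x⟫ + c)) μ :=
  .of_bound (by fun_prop) 1 (.of_forall fun x => by simpa using Real.abs_sin_le_one _)

lemma integral_cexp_inner_add_stdGaussian (t : E) (c : ℝ) :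
    ∫ x, Complex.exp (((⟪t, x⟫ + c : ℝ) : ℂ) * Complex.I) ∂(stdGaussian E) =
      (Real.exp (-(‖t‖ ^ 2 / 2)) : ℂ) * Complex.exp (c * Complex.I) := by
  have h := charFun_stdGaussian t
  simp_rw [charFun_apply, real_inner_comm t] at h
  simp_rw [Complex.ofReal_add, add_mul, Complex.exp_add, integral_mul_const, h]
  rw [Complex.ofReal_exp]
  push_cast
  ring_nf

lemma integral_cos_inner_add_stdGaussian (t : E) (c : ℝ) :
    ∫ x, Real.cos (⟪t, x⟫ + c) ∂(stdGaussian E) = Real.cos c * Real.exp (-(‖t‖ ^ 2 / 2)) := by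
  have h := congrArg Complex.re (integral_cexp_inner_add_stdGaussian t c)
  rw [← RCLike.re_eq_complex_re, ← integral_re, RCLike.re_eq_complex_re,
    Complex.re_ofReal_mul, Complex.exp_ofReal_mul_I_re] at h
  · simp_rw [Complex.exp_ofReal_mul_I_re] at h
    rw [h, mul_comm]
  · exact .of_bound (by fun_prop) 1
      (.of_forall fun x => (Complex.norm_exp_ofReal_mul_I _).le)

lemma integral_inner_mul_cos_inner_add_stdGaussian (u t : E) (c : ℝ) :
    ∫ x, ⟪u, x⟫ * Real.cos (⟪t, x⟫ + c) ∂(stdGaussian E) =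
      -(⟪u, t⟫ * Real.sin c * Real.exp (-(‖t‖ ^ 2 / 2))) := by
  have key : ∀ s : ℝ, ∫ x, Real.sin (⟪t + s • u, x⟫ + c) ∂(stdGaussian E) =
      Real.sin c * Real.exp (-((‖t‖ ^ 2 + 2 * s * ⟪u, t⟫ + s ^ 2 * ‖u‖ ^ 2) / 2)) := by
    intro s
    have h := integral_cos_inner_add_stdGaussian (t + s • u) (c - Real.pi / 2)
    simp_rw [← add_sub_assoc, Real.cos_sub_pi_div_two] at h
    rw [h, norm_add_sq_real, norm_smul, inner_smul_right, real_inner_comm, mul_pow,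
      Real.norm_eq_abs, sq_abs]
    ring_nf
  have h1 : HasDerivAt (fun s : ℝ => ∫ x, Real.sin (⟪t + s • u, x⟫ + c) ∂(stdGaussian E))
      (∫ x, ⟪u, x⟫ * Real.cos (⟪t + (0 : ℝ) • u, x⟫ + c) ∂(stdGaussian E)) 0 := by
    refine (hasDerivAt_integral_of_dominated_loc_of_deriv_le (s := Set.univ)
      (F' := fun s x => ⟪u, x⟫ * Real.cos (⟪t + s • u, x⟫ + c))
      (bound := fun x => |⟪u, x⟫|) Filter.univ_mem (.of_forall fun s => by fun_prop)
      (integrable_sin_inner_add _ _ _) (by fun_prop) (.of_forall fun x s _ => ?_)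
      (integrable_inner_stdGaussian u).abs (.of_forall fun x s _ => ?_)).2
    · rw [Real.norm_eq_abs, abs_mul]
      exact mul_le_of_le_one_right (abs_nonneg _) (Real.abs_cos_le_one _)
    · have : HasDerivAt (fun s : ℝ => ⟪t + s • u, x⟫ + c) ⟪u, x⟫ s := by
        simp_rw [inner_add_left, real_inner_smul_left]
        simpa using (((hasDerivAt_id s).mul_const ⟪u, x⟫).const_add ⟪t, x⟫).add_const c
      simpa [mul_comm] using this.sin
  have h2 : HasDerivAt (fun s : ℝ =>
      Real.sin c * Real.exp (-((‖t‖ ^ 2 + 2 * s * ⟪u, t⟫ + s ^ 2 * ‖u‖ ^ 2) / 2)))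
      (-(⟪u, t⟫ * Real.sin c * Real.exp (-(‖t‖ ^ 2 / 2)))) 0 := by
    have : HasDerivAt (fun s : ℝ => -((‖t‖ ^ 2 + 2 * s * ⟪u, t⟫ + s ^ 2 * ‖u‖ ^ 2) / 2))
        (-⟪u, t⟫) 0 := by
      have h := ((((((hasDerivAt_id (0 : ℝ)).const_mul 2).mul_const ⟪u, t⟫).const_add
        (‖t‖ ^ 2)).add (((hasDerivAt_id (0 : ℝ)).pow 2).mul_const (‖u‖ ^ 2))).div_const 2).neg
      refine h.congr_deriv ?_
      simp
    refine (this.exp.const_mul (Real.sin c)).congr_deriv ?_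
    simp
    ring
  rw [funext key] at h1
  simpa using h1.unique h2

lemma integral_affine_sub_cos_mul_stdGaussian {a : ℝ} (ha : a ≠ 0) (u v : E) (b c : ℝ) :
    ∫ x, (⟪u, x⟫ + b - Real.cos (2 * a * (⟪u, x⟫ + b)) / (2 * a)) *
        (⟪v, x⟫ + c - Real.cos (2 * a * (⟪v, x⟫ + c)) / (2 * a)) ∂(stdGaussian E) =
      (1 / (4 * a ^ 2)) *
        (2⁻¹ * Real.cos (2 * a * (b - c)) * Real.exp (-(2 * a ^ 2) * ‖u - v‖ ^ 2) +
          2⁻¹ * Real.cos (2 * a * (b + c)) * Real.exp (-(2 * a ^ 2) * ‖u + v‖ ^ 2)) +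
      ⟪u, v⟫ * (Real.sin (2 * a * c) * Real.exp (-(2 * a ^ 2) * ‖v‖ ^ 2) +
          Real.sin (2 * a * b) * Real.exp (-(2 * a ^ 2) * ‖u‖ ^ 2)) -
      (b / (2 * a)) * Real.cos (2 * a * c) * Real.exp (-(2 * a ^ 2) * ‖v‖ ^ 2) -
      (c / (2 * a)) * Real.cos (2 * a * b) * Real.exp (-(2 * a ^ 2) * ‖u‖ ^ 2) +
      (⟪u, v⟫ + b * c) := by
  have hcos (w : E) (e : ℝ) : ∫ x, Real.cos (2 * a * (⟪w, x⟫ + e)) ∂(stdGaussian E) =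
      Real.cos (2 * a * e) * Real.exp (-(2 * a ^ 2) * ‖w‖ ^ 2) := by
    have h := integral_cos_inner_add_stdGaussian ((2 * a) • w) (2 * a * e)
    simp_rw [real_inner_smul_left, ← mul_add] at h
    rw [h, norm_smul, mul_pow, Real.norm_eq_abs, sq_abs]
    ring_nf
  have hcos_int (w : E) (e : ℝ) :
      Integrable (fun x => Real.cos (2 * a * (⟪w, x⟫ + e))) (stdGaussian E) := by
    have h := integrable_cos_inner_add (stdGaussian E) ((2 * a) • w) (2 * a * e)
    simpa only [real_inner_smul_left, ← mul_add] using h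
  have hmul (z w : E) (e : ℝ) :
      ∫ x, ⟪z, x⟫ * Real.cos (2 * a * (⟪w, x⟫ + e)) ∂(stdGaussian E) =
      -(2 * a * ⟪z, w⟫ * Real.sin (2 * a * e) * Real.exp (-(2 * a ^ 2) * ‖w‖ ^ 2)) := by
    have h := integral_inner_mul_cos_inner_add_stdGaussian z ((2 * a) • w) (2 * a * e)
    simp_rw [real_inner_smul_left, ← mul_add] at h
    rw [h, norm_smul, mul_pow, Real.norm_eq_abs, sq_abs, real_inner_smul_right]
    ring_nf
  have hmul_int (z w : E) (e : ℝ) :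
      Integrable (fun x => ⟪z, x⟫ * Real.cos (2 * a * (⟪w, x⟫ + e))) (stdGaussian E) :=
    (integrable_inner_stdGaussian z).mul_bdd (c := 1) (by fun_prop)
      (.of_forall fun x => by simpa using Real.abs_cos_le_one _)
  have hquad : Integrable (fun x => ⟪u, x⟫ * ⟪v, x⟫) (stdGaussian E) :=
    (memLp_inner_stdGaussian u).integrable_mul (memLp_inner_stdGaussian v)
  have hexpand (x : E) : (⟪u, x⟫ + b - Real.cos (2 * a * (⟪u, x⟫ + b)) / (2 * a)) *
        (⟪v, x⟫ + c - Real.cos (2 * a * (⟪v, x⟫ + c)) / (2 * a)) =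
      ⟪u, x⟫ * ⟪v, x⟫ + c * ⟪u, x⟫ + b * ⟪v, x⟫ + b * c
      + -(2 * a)⁻¹ * (⟪u, x⟫ * Real.cos (2 * a * (⟪v, x⟫ + c)))
      + -(2 * a)⁻¹ * (⟪v, x⟫ * Real.cos (2 * a * (⟪u, x⟫ + b)))
      + -(b / (2 * a)) * Real.cos (2 * a * (⟪v, x⟫ + c))
      + -(c / (2 * a)) * Real.cos (2 * a * (⟪u, x⟫ + b))
      + 1 / (8 * a ^ 2) * Real.cos (2 * a * (⟪u - v, x⟫ + (b - c)))
      + 1 / (8 * a ^ 2) * Real.cos (2 * a * (⟪u + v, x⟫ + (b + c))) := by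
    have h1 : 2 * a * (⟪u - v, x⟫ + (b - c)) =
        2 * a * (⟪u, x⟫ + b) - 2 * a * (⟪v, x⟫ + c) := by rw [inner_sub_left]; ring
    have h2 : 2 * a * (⟪u + v, x⟫ + (b + c)) =
        2 * a * (⟪u, x⟫ + b) + 2 * a * (⟪v, x⟫ + c) := by rw [inner_add_left]; ring
    rw [h1, h2, Real.cos_sub, Real.cos_add]
    field_simp
    ring
  have hu := integrable_inner_stdGaussian u
  have hv := integrable_inner_stdGaussian v
  simp_rw [hexpand]
  iterate 9 rw [integral_add (by fun_prop (disch := assumption)) (by fun_prop (disch := assumption))]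
  simp_rw [integral_const_mul, hcos, hmul, integral_inner_stdGaussian,
    integral_inner_mul_inner_stdGaussian, real_inner_comm u v]
  simp only [integral_const, probReal_univ, smul_eq_mul]
  field_simp
  ring

end StdGaussian

lemma snake_sub_eq {a : ℝ} (ha : a ≠ 0) (u : ℝ) :
    snake a u - 1 / (2 * a) = u - Real.cos (2 * a * u) / (2 * a) := by
  rw [snake, mul_assoc, Real.cos_two_mul, Real.cos_sq']
  field_simp
  ring

/-- the neural network kernel of the shifted snake activation
`σ(u) = snake_a(u) − 1/(2a) = u − cos(2au)/(2a)` under the standard Gaussian measure. -/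
theorem shifted_snake_kernel_standard_gaussian
    (d : ℕ) (hd : 1 ≤ d) (a : ℝ) (ha : 0 < a) (wi wj : Fin d → ℝ) (bi bj : ℝ) :
    ∫ x : Fin d → ℝ,
        (snake a (∑ l : Fin d, wi l * x l + bi) - 1 / (2 * a)) *
        (snake a (∑ l : Fin d, wj l * x l + bj) - 1 / (2 * a))
        ∂(Measure.pi fun _ : Fin d => gaussianReal 0 1) =
      (1 / (4 * a ^ 2)) *
        (2⁻¹ * Real.cos (2 * a * (bi - bj)) *
            Real.exp (-(2 * a ^ 2) * ∑ l : Fin d, (wi l - wj l) ^ 2) +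
          2⁻¹ * Real.cos (2 * a * (bi + bj)) *
            Real.exp (-(2 * a ^ 2) * ∑ l : Fin d, (wi l + wj l) ^ 2)) +
      (∑ l : Fin d, wi l * wj l) *
        (Real.sin (2 * a * bj) * Real.exp (-(2 * a ^ 2) * ∑ l : Fin d, (wj l) ^ 2) +
          Real.sin (2 * a * bi) * Real.exp (-(2 * a ^ 2) * ∑ l : Fin d, (wi l) ^ 2)) -
      (bi / (2 * a)) * Real.cos (2 * a * bj) *
        Real.exp (-(2 * a ^ 2) * ∑ l : Fin d, (wj l) ^ 2) -
      (bj / (2 * a)) * Real.cos (2 * a * bi) *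
        Real.exp (-(2 * a ^ 2) * ∑ l : Fin d, (wi l) ^ 2) +
      ((∑ l : Fin d, wi l * wj l) + bi * bj) := by
  have h := integral_affine_sub_cos_mul_stdGaussian ha.ne'
    (WithLp.toLp 2 wi) (WithLp.toLp 2 wj) bi bj
  rw [← map_pi_eq_stdGaussian, integral_map (by fun_prop)
    (Continuous.aestronglyMeasurable (by fun_prop))] at h
  simp_rw [snake_sub_eq ha.ne']
  simpa [EuclideanSpace.norm_sq_eq, PiLp.inner_apply, mul_comm] using h
end

section
/- Let d ≥ 1, let γ be the standard Gaussian probability measure on ℝ^d (the d-fold product of gaussianReal 0 1), let a > 0, and let snake_a(u) = u + sin²(au)/a. For w_i, w_j ∈ ℝ^d and b_i, b_j ∈ ℝ, ∫_{ℝ^d} snake_a(⟨w_i,x⟩+b_i) snake_a(⟨w_j,x⟩+b_j) γ(dx) equals K₀ + 1/(4a²) + (1/(2a))[b_i − (1/(2a)) cos(2a b_i) exp(−2a²‖w_i‖²) + b_j − (1/(2a)) cos(2a b_j) exp(−2a²‖w_j‖²)], where K₀ = ∫_{ℝ^d} (snake_a(⟨w_i,x⟩+b_i) − 1/(2a))(snake_a(⟨w_j,x⟩+b_j)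 − 1/(2a)) γ(dx). -/
open MeasureTheory ProbabilityTheory

lemma memLp_two_linear_pi_gaussian {ι : Type*} [Fintype ι] (w : ι → ℝ) (b : ℝ) :
    MemLp (fun x : ι → ℝ => ∑ l, w l * x l + b) 2 (Measure.pi fun _ => gaussianReal 0 1) := by
  refine (memLp_finsetSum _ fun l _ => ?_).add (memLp_const b)
  exact ((memLp_id_gaussianReal' 2 (by simp)).comp_measurePreserving
    (measurePreserving_eval (fun _ : ι => gaussianReal 0 1) l)).const_mul (w l)

lemma integral_linear_pi_gaussian {ι : Type*} [Fintype ι] (w : ι → ℝ) (b : ℝ) :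
    ∫ x : ι → ℝ, (∑ l, w l * x l + b) ∂(Measure.pi fun _ => gaussianReal 0 1) = b := by
  have hint (l : ι) :
      Integrable (fun x : ι → ℝ => w l * x l) (Measure.pi fun _ => gaussianReal 0 1) :=
    (((memLp_id_gaussianReal' 1 (by simp)).comp_measurePreserving
      (measurePreserving_eval (fun _ : ι => gaussianReal 0 1) l)).integrable le_rfl).const_mul (w l)
  have hmean (l : ι) : ∫ x : ι → ℝ, x l ∂(Measure.pi fun _ => gaussianReal 0 1) = 0 := by
    exact (integral_comp_eval (μ := fun _ : ι => gaussianReal 0 1) (i := l) (f := fun y : ℝ => y)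
      (by fun_prop)).trans integral_id_gaussianReal
  rw [integral_add (integrable_finsetSum _ fun l _ => hint l) (integrable_const b),
    integral_finsetSum _ fun l _ => hint l]
  simp [integral_const_mul, hmean]

lemma integral_cexp_linear_pi_gaussian {ι : Type*} [Fintype ι] (w : ι → ℝ) :
    ∫ x : ι → ℝ, Complex.exp ((∑ l, w l * x l : ℝ) * Complex.I)
      ∂(Measure.pi fun _ => gaussianReal 0 1) =
      Complex.exp (-(∑ l, w l ^ 2 : ℝ) / 2) := by
  have hprod (x : ι → ℝ) : Complex.exp ((∑ l, w l * x l : ℝ) * Complex.I) =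
      ∏ l, Complex.exp (w l * x l * Complex.I) := by
    rw [← Complex.exp_sum, ← Finset.sum_mul]
    push_cast
    rfl
  simp_rw [hprod]
  rw [integral_fintype_prod_eq_prod (𝕜 := ℂ) (μ := fun _ : ι => gaussianReal 0 1)
    (fun l (y : ℝ) => Complex.exp (w l * y * Complex.I))]
  simp_rw [← charFun_apply_real, charFun_gaussianReal]
  rw [← Complex.exp_sum]
  congr 1
  push_cast
  rw [← Finset.sum_neg_distrib, Finset.sum_div]
  exact Finset.sum_congr rfl fun l _ => by simp; ring

lemma integral_cos_linear_pi_gaussian {ι : Type*} [Fintype ι] (w : ι → ℝ) (b : ℝ) :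
    ∫ x : ι → ℝ, Real.cos (∑ l, w l * x l + b) ∂(Measure.pi fun _ => gaussianReal 0 1) =
      Real.cos b * Real.exp (-(∑ l, w l ^ 2) / 2) := by
  have hre (x : ι → ℝ) : Real.cos (∑ l, w l * x l + b) =
      RCLike.re (Complex.exp ((∑ l, w l * x l : ℝ) * Complex.I) * Complex.exp (b * Complex.I)) := by
    rw [← Complex.exp_add, ← add_mul, ← Complex.ofReal_add]
    exact (Complex.exp_ofReal_mul_I_re _).symm
  have hint : Integrable (fun x : ι → ℝ =>
      Complex.exp ((∑ l, w l * x l : ℝ) * Complex.I) * Complex.exp (b * Complex.I))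
      (Measure.pi fun _ => gaussianReal 0 1) := by
    refine Integrable.of_bound (Continuous.aestronglyMeasurable (by fun_prop)) 1 (.of_forall fun x => ?_)
    rw [norm_mul, Complex.norm_exp_ofReal_mul_I, Complex.norm_exp_ofReal_mul_I, one_mul]
  simp_rw [hre]
  rw [integral_re hint, integral_mul_const, integral_cexp_linear_pi_gaussian, mul_comm,
    ← Complex.ofReal_neg, ← Complex.ofReal_ofNat, ← Complex.ofReal_div, ← Complex.ofReal_exp]
  exact (Complex.re_mul_ofReal _ _).trans (by rw [Complex.exp_ofReal_mul_I_re])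

lemma snake_eq_cos {a : ℝ} (ha : a ≠ 0) (u : ℝ) :
    snake a u = u + (1 / (2 * a) - 1 / (2 * a) * Real.cos (2 * a * u)) := by
  rw [snake, Real.sin_sq_eq_half_sub, ← mul_assoc]
  field_simp

lemma memLp_two_cos_linear_pi_gaussian {ι : Type*} [Fintype ι] (a : ℝ) (w : ι → ℝ) (b : ℝ) :
    MemLp (fun x : ι → ℝ => Real.cos (a * (∑ l, w l * x l + b))) 2
      (Measure.pi fun _ => gaussianReal 0 1) :=
  MemLp.of_bound (Continuous.aestronglyMeasurable (by fun_prop)) 1 (.of_forall fun _ => Real.abs_cos_le_one _)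

lemma memLp_two_snake_pi_gaussian {ι : Type*} [Fintype ι] {a : ℝ} (ha : a ≠ 0)
    (w : ι → ℝ) (b : ℝ) :
    MemLp (fun x : ι → ℝ => snake a (∑ l, w l * x l + b)) 2
      (Measure.pi fun _ => gaussianReal 0 1) := by
  simp_rw [snake_eq_cos ha]
  exact (memLp_two_linear_pi_gaussian w b).add
    ((memLp_const _).sub ((memLp_two_cos_linear_pi_gaussian (2 * a) w b).const_mul _))

lemma integral_snake_pi_gaussian {ι : Type*} [Fintype ι] {a : ℝ} (ha : a ≠ 0)
    (w : ι → ℝ) (b : ℝ) :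
    ∫ x : ι → ℝ, snake a (∑ l, w l * x l + b) ∂(Measure.pi fun _ => gaussianReal 0 1) =
      b + (1 / (2 * a) - 1 / (2 * a) * (Real.cos (2 * a * b) *
        Real.exp (-(2 * a ^ 2) * ∑ l, w l ^ 2))) := by
  have hlin := (memLp_two_linear_pi_gaussian w b).integrable one_le_two
  have hcos := ((memLp_two_cos_linear_pi_gaussian (2 * a) w b).integrable one_le_two).const_mul
    (1 / (2 * a))
  have hval : ∫ x : ι → ℝ, Real.cos (2 * a * (∑ l, w l * x l + b))
      ∂(Measure.pi fun _ => gaussianReal 0 1) =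
      Real.cos (2 * a * b) * Real.exp (-(2 * a ^ 2) * ∑ l, w l ^ 2) := by
    convert integral_cos_linear_pi_gaussian (fun l => 2 * a * w l) (2 * a * b) using 5
    · rw [mul_add, Finset.mul_sum]
      simp_rw [mul_assoc]
    · simp_rw [mul_pow, ← Finset.mul_sum]
      ring
  have hdiff : Integrable (fun x : ι → ℝ =>
      1 / (2 * a) - 1 / (2 * a) * Real.cos (2 * a * (∑ l, w l * x l + b)))
      (Measure.pi fun _ => gaussianReal 0 1) := (integrable_const _).sub hcos
  simp_rw [snake_eq_cos ha]
  rw [integral_add hlin hdiff, integral_sub (integrable_const _) hcos,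
    integral_linear_pi_gaussian, integral_const_mul, hval]
  simp

/-- the neural network kernel of the snake activation under the standard
Gaussian measure, expressed in terms of the kernel `K₀` of the shifted activation
`snake_a(·) − 1/(2a)`. -/
theorem snake_kernel_standard_gaussian
    (d : ℕ) (hd : 1 ≤ d) (a : ℝ) (ha : 0 < a) (wi wj : Fin d → ℝ) (bi bj : ℝ) :
    ∫ x : Fin d → ℝ,
        snake a (∑ l : Fin d, wi l * x l + bi) * snake a (∑ l : Fin d, wj l * x l + bj)
        ∂(Measure.pi fun _ : Fin d => gaussianReal 0 1) =
      (∫ x : Fin d → ℝ,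
        (snake a (∑ l : Fin d, wi l * x l + bi) - 1 / (2 * a)) *
        (snake a (∑ l : Fin d, wj l * x l + bj) - 1 / (2 * a))
        ∂(Measure.pi fun _ : Fin d => gaussianReal 0 1)) +
      1 / (4 * a ^ 2) +
      (1 / (2 * a)) *
        (bi - (1 / (2 * a)) * Real.cos (2 * a * bi) *
            Real.exp (-(2 * a ^ 2) * ∑ l : Fin d, (wi l) ^ 2) +
          bj - (1 / (2 * a)) * Real.cos (2 * a * bj) *
            Real.exp (-(2 * a ^ 2) * ∑ l : Fin d, (wj l) ^ 2)) := by
  have hi := memLp_two_snake_pi_gaussian ha.ne' wi bi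
  have hj := memLp_two_snake_pi_gaussian ha.ne' wj bj
  set c : ℝ := 1 / (2 * a) with hc
  have hK : Integrable (fun x : Fin d → ℝ =>
      (snake a (∑ l, wi l * x l + bi) - c) * (snake a (∑ l, wj l * x l + bj) - c))
      (Measure.pi fun _ => gaussianReal 0 1) :=
    (hi.sub (memLp_const c)).integrable_mul (hj.sub (memLp_const c))
  have hi' := (hi.integrable one_le_two).const_mul c
  have hj' := (hj.integrable one_le_two).const_mul c
  have hlin : Integrable (fun x : Fin d → ℝ =>
      c * snake a (∑ l, wi l * x l + bi) + c * snake a (∑ l, wj l * x l + bj))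
      (Measure.pi fun _ => gaussianReal 0 1) := hi'.add hj'
  have haff : Integrable (fun x : Fin d → ℝ =>
      c * snake a (∑ l, wi l * x l + bi) + c * snake a (∑ l, wj l * x l + bj) - c ^ 2)
      (Measure.pi fun _ => gaussianReal 0 1) := hlin.sub (integrable_const _)
  have hsplit (s t : ℝ) : s * t = (s - c) * (t - c) + (c * s + c * t - c ^ 2) := by ring
  conv_lhs => enter [2, x]; rw [hsplit]
  rw [integral_add hK haff,
    integral_sub hlin (integrable_const _), integral_add hi' hj',
    integral_const_mul, integral_const_mul, integral_snake_pi_gaussian ha.ne',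
    integral_snake_pi_gaussian ha.ne', ← hc]
  have hc2 : 1 / (4 * a ^ 2) = c ^ 2 := by rw [hc]; ring
  rw [hc2]
  simp
  ring
end
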